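/- Let G : T → {nonempty compact subsets of ℝ^d} be graph measurable, i.e. {(t,v) ∈ T × ℝ^d : v ∈ G(t)} belongs to the product of the Lebesgue σ-algebra on T with the Borel σ-algebra of ℝ^d. Let S¹_G = {g ∈ L¹(T,ℝ^d) : g(t) ∈ G(t) for a.e. t ∈ T}, and assume S¹_G is nonempty and uniformly integrable. Then the closure of S¹_G in L¹(T,ℝ^d) with respect to the weak norm ‖·‖_w equals S¹_{conv G} = {g ∈ L¹(T,ℝ^d) : g(t) ∈ conv G(t) for a.e. t ∈ T}; equivalently, f ∈ L¹(T,ℝ^d) satisfies f(t) ∈ conv G(t) for a.e. t ∈ T if and only if there exist gₙ ∈ S¹_G with ‖gₙ − f‖_w → 0. -/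

import Mathlib

open MeasureTheory Set Metric Filter Topology

noncomputable section

/-- The Lebesgue σ-algebra on `ℝ` (completion of Borel w.r.t. Lebesgue measure). -/
def lebesgueSigmaAlgebra : MeasurableSpace ℝ :=
  inferInstanceAs (MeasurableSpace (NullMeasurableSpace ℝ volume))

/-- The weak norm on `L¹(T, E)`: `‖v‖_w = sup_{0 ≤ t ≤ b} ‖∫₀ᵗ v(s) ds‖`. -/
def weakNorm (b : ℝ) {E : Type*} [NormedAddCommGroup E] [NormedSpace ℝ E]
    (v : ℝ → E) : ℝ :=
  ⨆ t : Icc (0:ℝ) b, ‖∫ s in (0:ℝ)..(t : ℝ), v s‖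

lemma exists_lt_measure_image_inter {X : Type*} [MeasurableSpace X] (μ : Measure X)
    (φ : (ℕ → ℕ) → X) {c : ENNReal} {S : Set (ℕ → ℕ)} (hS : c < μ (φ '' S)) (k : ℕ) :
    ∃ m : ℕ, c < μ (φ '' (S ∩ {x | x k ≤ m})) := by
  have hU : φ '' S = ⋃ m : ℕ, φ '' (S ∩ {x | x k ≤ m}) := by
    rw [← image_iUnion, ← inter_iUnion]
    congr 1
    ext x
    simp only [mem_inter_iff, mem_iUnion, mem_ofPred_eq]
    exact ⟨fun h => ⟨h, _, le_rfl⟩, fun h => h.1⟩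
  have hmono : Monotone fun m : ℕ => φ '' (S ∩ {x | x k ≤ m}) := fun a b hab =>
    image_mono (inter_subset_inter_right _ fun x (hx : x k ≤ a) => hx.trans hab)
  rw [hU, hmono.measure_iUnion] at hS
  exact lt_iSup_iff.1 hS

/-- Inner regularity by compact sets for continuous images of the Baire space. -/
lemma exists_isCompact_le_measure_image {X : Type*} [TopologicalSpace X] [MeasurableSpace X]
    (μ : Measure X) [μ.OuterRegular] {φ : (ℕ → ℕ) → X} (hφ : Continuous φ) {c : ENNReal}
    (hc : c < μ (range φ)) :
    ∃ K : Set (ℕ → ℕ), IsCompact K ∧ c ≤ μ (φ '' K) := by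
  have step : ∀ S : Set (ℕ → ℕ), c < μ (φ '' S) → ∀ k,
      ∃ m : ℕ, c < μ (φ '' (S ∩ {x | x k ≤ m})) :=
    fun S hS k => exists_lt_measure_image_inter μ φ hS k
  choose! m hm using step
  let S : ℕ → Set (ℕ → ℕ) := fun k => Nat.rec univ (fun k S => S ∩ {x | x k ≤ m S k}) k
  have hSsucc : ∀ k, S (k + 1) = S k ∩ {x | x k ≤ m (S k) k} := fun k => rfl
  have hSc : ∀ k, c < μ (φ '' S k) := by
    intro k
    induction k with
    | zero => simpa [S] using hc
    | succ k ih => rw [hSsucc]; exact hm _ ih k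
  have hSmem : ∀ k, ∀ x ∈ S k, ∀ i < k, x i ≤ m (S i) i := by
    intro k
    induction k with
    | zero => intro x _ i hi; omega
    | succ k ih =>
      intro x hx i hi
      rw [hSsucc] at hx
      rcases Nat.lt_succ_iff_lt_or_eq.1 hi with h | rfl
      · exact ih x hx.1 i h
      · exact hx.2
  let K : Set (ℕ → ℕ) := univ.pi fun k => Iic (m (S k) k)
  have hK : IsCompact K := isCompact_univ_pi fun k => (finite_Iic _).isCompact
  refine ⟨K, hK, ?_⟩
  rw [Set.measure_eq_iInf_isOpen]
  refine le_iInf fun U => le_iInf fun hKU => le_iInf fun hU => ?_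
  suffices ∃ k, S k ⊆ φ ⁻¹' U by
    obtain ⟨k, hk⟩ := this
    exact (hSc k).le.trans (measure_mono (image_subset_iff.2 hk))
  by_contra! hcon
  have hx : ∀ k, ∃ x ∈ S k, x ∉ φ ⁻¹' U := fun k => not_subset.1 (hcon k)
  choose x hxS hxU using hx
  let y : ℕ → ℕ → ℕ := fun k i => min (x k i) (m (S i) i)
  have hyK : ∀ k, y k ∈ K := fun k i _ => mem_Iic.2 (min_le_right _ _)
  obtain ⟨z, hzK, σ, hσ, hlim⟩ := hK.tendsto_subseq hyK
  have hxlim : Tendsto (x ∘ σ) atTop (𝓝 z) := by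
    rw [tendsto_pi_nhds] at hlim ⊢
    intro i
    refine (hlim i).congr' ?_
    filter_upwards [eventually_gt_atTop i] with j hj
    exact min_eq_left (hSmem _ _ (hxS (σ j)) i (hj.trans_le (hσ.id_le j)))
  have hzU : φ ⁻¹' U ∈ 𝓝 z := (hU.preimage hφ).mem_nhds (hKU (mem_image_of_mem φ hzK))
  obtain ⟨j, hj⟩ := (hxlim.eventually hzU).exists
  exact hxU _ hj

lemma measurable_sInf_section {C : Set (ℝ × ℝ)} (hC : IsCompact C) :
    Measurable fun t => sInf {y | (t, y) ∈ C} := by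
  have hD : IsCompact (Prod.fst '' C) := hC.image continuous_fst
  refine measurable_of_Iic fun a => ?_
  have hCa : IsCompact (Prod.fst '' (C ∩ {p : ℝ × ℝ | p.2 ≤ a})) :=
    (hC.inter_right (isClosed_le continuous_snd continuous_const)).image continuous_fst
  have hsec : ∀ t, IsCompact {y | (t, y) ∈ C} := fun t => by
    have := (hC.inter_right (isClosed_eq continuous_fst (continuous_const (y := t)))).image
      continuous_snd
    convert this using 1
    ext y
    constructor
    · exact fun h => ⟨(t, y), ⟨h, rfl⟩, rfl⟩
    · rintro ⟨⟨s, y'⟩, ⟨h, rfl⟩, rfl⟩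
      exact h
  have : (fun t => sInf {y | (t, y) ∈ C}) ⁻¹' Iic a =
      Prod.fst '' (C ∩ {p : ℝ × ℝ | p.2 ≤ a}) ∪ ((Prod.fst '' C)ᶜ ∩ {_t | 0 ≤ a}) := by
    ext t
    by_cases ht : t ∈ Prod.fst '' C
    · have hne : {y | (t, y) ∈ C}.Nonempty := by
        obtain ⟨⟨s, y⟩, h, rfl⟩ := ht
        exact ⟨y, h⟩
      simp only [mem_preimage, mem_Iic, mem_union, mem_inter_iff, mem_compl_iff, ht,
        not_true_eq_false, false_and, or_false]
      constructor
      · exact fun h => ⟨(t, _), ⟨(hsec t).sInf_mem hne, h⟩, rfl⟩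
      · rintro ⟨⟨s, y⟩, ⟨h, hy⟩, rfl⟩
        exact (csInf_le (hsec _).bddBelow h).trans hy
    · have hemp : {y | (t, y) ∈ C} = ∅ :=
        eq_empty_of_forall_notMem fun y hy => ht ⟨(t, y), hy, rfl⟩
      have : t ∉ Prod.fst '' (C ∩ {p : ℝ × ℝ | p.2 ≤ a}) :=
        fun h => ht (image_mono inter_subset_left h)
      simp [hemp, -mem_image, ht, this]
  rw [this]
  exact hCa.measurableSet.union (hD.measurableSet.compl.inter (MeasurableSet.const _))

lemma sInf_section_mem {C : Set (ℝ × ℝ)} (hC : IsCompact C) {t : ℝ} (ht : t ∈ Prod.fst '' C) :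
    (t, sInf {y | (t, y) ∈ C}) ∈ C := by
  have hcl : IsClosed {y | (t, y) ∈ C} := hC.isClosed.preimage (by fun_prop : Continuous fun y : ℝ => (t, y))
  have hne : {y | (t, y) ∈ C}.Nonempty := by
    obtain ⟨⟨s, y⟩, h, rfl⟩ := ht
    exact ⟨y, h⟩
  refine hcl.csInf_mem hne ?_
  refine (hC.image continuous_snd).bddBelow.mono ?_
  exact fun y hy => ⟨(t, y), hy, rfl⟩

lemma exists_isCompact_subset_measure_fst_image (μ : Measure ℝ) [IsFiniteMeasure μ]
    {B : Set (ℝ × ℝ)} (hB : MeasurableSet B) {c : ENNReal} (hc : c < μ (Prod.fst '' B)) :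
    ∃ C ⊆ B, IsCompact C ∧ c ≤ μ (Prod.fst '' C) := by
  have hA := hB.analyticSet
  rw [AnalyticSet] at hA
  rcases hA with rfl | ⟨φ, hφ, rfl⟩
  · simp at hc
  · rw [← range_comp] at hc
    obtain ⟨K, hK, hKc⟩ := exists_isCompact_le_measure_image μ (continuous_fst.comp hφ) hc
    refine ⟨φ '' K, image_subset_range _ _, hK.image hφ, ?_⟩
    rwa [← image_comp]

lemma exists_measurable_selection_real (μ : Measure ℝ) [IsFiniteMeasure μ]
    {B : Set (ℝ × ℝ)} (hB : MeasurableSet B) (hne : ∀ᵐ t ∂μ, ∃ y, (t, y) ∈ B) :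
    ∃ u : ℝ → ℝ, Measurable u ∧ ∀ᵐ t ∂μ, (t, u t) ∈ B := by
  classical
  by_cases hμ : μ univ = 0
  · rw [Measure.measure_univ_eq_zero] at hμ
    exact ⟨0, measurable_const, by simp [hμ]⟩
  have hproj : μ (Prod.fst '' B) = μ univ := by
    refine measure_congr ?_
    filter_upwards [hne] with t ⟨y, hy⟩
    exact propext ⟨fun _ => mem_univ t, fun _ => ⟨(t, y), hy, rfl⟩⟩
  have hC : ∀ n : ℕ, ∃ C ⊆ B, IsCompact C ∧ μ univ - ((n : ENNReal) + 1)⁻¹ ≤ μ (Prod.fst '' C) := by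
    intro n
    refine exists_isCompact_subset_measure_fst_image μ hB ?_
    rw [hproj]
    exact ENNReal.sub_lt_self (measure_ne_top _ _) hμ (by simp)
  choose C hCB hCc hCμ using hC
  let D : Set ℝ := ⋃ n, Prod.fst '' C n
  have hDn : ∀ n, MeasurableSet (Prod.fst '' C n) := fun n =>
    ((hCc n).image continuous_fst).measurableSet
  have hD : MeasurableSet D := MeasurableSet.iUnion hDn
  have hDuniv : μ univ ≤ μ D := by
    have : ∀ n : ℕ, μ univ ≤ μ D + ((n : ENNReal) + 1)⁻¹ := fun n =>
      tsub_le_iff_right.1 ((hCμ n).trans (measure_mono (subset_iUnion (fun n => Prod.fst '' C n) n)))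
    have hlim : Tendsto (fun n : ℕ => μ D + ((n : ENNReal) + 1)⁻¹) atTop (𝓝 (μ D + 0)) := by
      refine tendsto_const_nhds.add ?_
      have := (tendsto_add_atTop_iff_nat 1).2 ENNReal.tendsto_inv_nat_nhds_zero
      simpa using this
    rw [add_zero] at hlim
    exact ge_of_tendsto' hlim this
  have hDae : ∀ᵐ t ∂μ, t ∈ D := by
    rw [ae_iff]
    have := measure_compl hD (measure_ne_top μ D)
    rw [tsub_eq_zero_of_le hDuniv] at this
    exact this
  have hex : ∀ t, ∃ n, t ∈ Prod.fst '' C n ∨ t ∉ D := by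
    intro t
    by_cases h : t ∈ D
    · obtain ⟨n, hn⟩ := mem_iUnion.1 h
      exact ⟨n, Or.inl hn⟩
    · exact ⟨0, Or.inr h⟩
  refine ⟨fun t => sInf {y | (t, y) ∈ C (Nat.find (hex t))}, ?_, ?_⟩
  · exact Measurable.find (p := fun n t => t ∈ Prod.fst '' C n ∨ t ∉ D)
      (f := fun n t => sInf {y | (t, y) ∈ C n}) (fun n => measurable_sInf_section (hCc n))
      (fun n => (hDn n).union hD.compl) hex
  · filter_upwards [hDae] with t ht
    exact hCB _ (sInf_section_mem (hCc _) ((Nat.find_spec (hex t)).resolve_right (not_not.2 ht)))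

/-- The von Neumann measurable selection theorem, in its almost everywhere form. -/
theorem exists_measurable_selection {Y : Type*} [MeasurableSpace Y] [StandardBorelSpace Y]
    [Nonempty Y] (μ : Measure ℝ) [IsFiniteMeasure μ]
    {B : Set (ℝ × Y)} (hB : MeasurableSet B) (hne : ∀ᵐ t ∂μ, ∃ y, (t, y) ∈ B) :
    ∃ u : ℝ → Y, Measurable u ∧ ∀ᵐ t ∂μ, (t, u t) ∈ B := by
  have he := measurableEmbedding_embeddingReal Y
  have hpe : MeasurableEmbedding (Prod.map (id : ℝ → ℝ) (embeddingReal Y)) :=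
    MeasurableEmbedding.id.prodMap he
  obtain ⟨u, hu, huB⟩ := exists_measurable_selection_real μ (hpe.measurableSet_image.2 hB)
    (hne.mono fun t ⟨y, hy⟩ => ⟨embeddingReal Y y, (t, y), hy, rfl⟩)
  refine ⟨fun t => he.invFun (u t), he.measurable_invFun.comp hu, ?_⟩
  filter_upwards [huB] with t ⟨⟨s, y⟩, hy, hsy⟩
  simp only [Prod.map_apply, id_eq, Prod.mk.injEq] at hsy
  obtain ⟨rfl, hsy⟩ := hsy
  rw [← hsy, he.leftInverse_invFun y]
  exact hy

lemma exists_partition_Ico {ι : Type*} [MeasurableSpace ι] [Nonempty ι]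
    (S : Finset ι) (l : ι → ℝ) (hl : ∀ i, 0 ≤ l i) (a : ℝ) :
    ∃ κ : ℝ → ι, Measurable κ ∧ (∀ s ∈ Ico a (a + ∑ i ∈ S, l i), κ s ∈ S) ∧
      ∀ i ∈ S, volume.real (κ ⁻¹' {i} ∩ Ico a (a + ∑ i ∈ S, l i)) = l i := by
  classical
  induction S using Finset.induction generalizing a with
  | empty => exact ⟨fun _ => Classical.arbitrary ι, measurable_const, by simp, by simp⟩
  | insert j S hj ih =>
    obtain ⟨κ, hκ, hκS, hκl⟩ := ih (a + l j)
    rw [Finset.sum_insert hj, ← add_assoc]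
    have hsum : 0 ≤ ∑ i ∈ S, l i := Finset.sum_nonneg fun i _ => hl i
    refine ⟨fun s => if s < a + l j then j else κ s,
      Measurable.ite measurableSet_Iio measurable_const hκ, ?_, ?_⟩
    · rintro s ⟨hs1, hs2⟩
      dsimp only
      split_ifs with h
      · exact Finset.mem_insert_self _ _
      · exact Finset.mem_insert_of_mem (hκS s ⟨not_lt.1 h, hs2⟩)
    · intro i hi
      rcases Finset.mem_insert.1 hi with rfl | hiS
      · have : (fun s => if s < a + l i then i else κ s) ⁻¹' {i} ∩
            Ico a (a + l i + ∑ i ∈ S, l i) = Ico a (a + l i) := by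
          ext s
          simp only [mem_inter_iff, mem_preimage, mem_singleton_iff, mem_Ico]
          constructor
          · rintro ⟨h1, h2, h3⟩
            refine ⟨h2, ?_⟩
            by_contra h
            rw [if_neg h] at h1
            exact hj (h1 ▸ hκS s ⟨not_lt.1 h, h3⟩)
          · rintro ⟨h1, h2⟩
            exact ⟨if_pos h2, h1, by linarith⟩
        rw [this, Real.volume_real_Ico_of_le (by linarith [hl i])]
        ring
      · rw [← hκl i hiS]
        congr 1
        have hij : j ≠ i := fun h => hj (h ▸ hiS)
        ext s
        simp only [mem_inter_iff, mem_preimage, mem_singleton_iff, mem_Ico]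
        by_cases h : s < a + l j
        · simp [h, hij, not_le.2 h]
        · simp only [h, if_false, not_lt.1 h, true_and]
          have := hl j
          refine and_congr_right fun _ => ⟨fun h' => h'.2, fun h' => ⟨?_, h'⟩⟩
          linarith [not_lt.1 h]

lemma integrableOn_of_abs_le_one {r : ℝ → ℝ} (hr : Measurable r) (hr1 : ∀ s, |r s| ≤ 1)
    {A : Set ℝ} (hA : volume A ≠ ⊤) : IntegrableOn r A := by
  have : IsFiniteMeasure (volume.restrict A) := ⟨by simpa using hA.lt_top⟩
  exact Integrable.of_bound hr.aestronglyMeasurable 1 (Eventually.of_forall hr1)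

/-- Chattering: a measurable family of weights is approximated by a measurable choice of index. -/
lemma exists_measurable_index {ι : Type*} [Fintype ι] [MeasurableSpace ι]
    [DiscreteMeasurableSpace ι] [Nonempty ι] (w : ι → ℝ → ℝ) (hw : ∀ i, Measurable (w i))
    (hw0 : ∀ i s, 0 ≤ w i s) (hw1 : ∀ s, ∑ i, w i s = 1) {h : ℝ} (hh : 0 < h) :
    ∃ κ : ℝ → ι, Measurable κ ∧ ∀ i, ∀ t, 0 ≤ t →
      |∫ s in Ioc 0 t, ((κ ⁻¹' {i}).indicator 1 s - w i s)| ≤ h := by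
  classical
  have hwle : ∀ i s, |w i s| ≤ 1 := fun i s => by
    rw [abs_of_nonneg (hw0 i s), ← hw1 s]
    exact Finset.single_le_sum (fun j _ => hw0 j s) (Finset.mem_univ i)
  have hwint : ∀ i a c, IntegrableOn (w i) (Ico a c) := fun i a c =>
    integrableOn_of_abs_le_one (hw i) (hwle i) (by simp)
  let l : ℕ → ι → ℝ := fun k i => ∫ s in Ico (k * h) (k * h + h), w i s
  have hl0 : ∀ k i, 0 ≤ l k i := fun k i => integral_nonneg (hw0 i)
  have hlsum : ∀ k, ∑ i, l k i = h := by
    intro k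
    simp only [l]
    rw [← integral_finsetSum _ fun i _ => hwint i _ _]
    simp only [hw1]
    simp [hh.le]
  have hex := fun k : ℕ => exists_partition_Ico Finset.univ (l k) (hl0 k) (k * h)
  choose κ hκ _ hκl using hex
  simp only [hlsum, Finset.mem_univ, true_imp_iff] at hκl
  have hfloor : Measurable fun s : ℝ => ⌊s / h⌋₊ := Nat.measurable_floor.comp (measurable_id.div_const h)
  have hκm : Measurable fun s => κ ⌊s / h⌋₊ s := by
    have : Measurable fun p : ℝ × ℕ => κ p.2 p.1 := measurable_from_prod_countable_left fun n => hκ n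
    exact this.comp (measurable_id.prodMk hfloor)
  refine ⟨_, hκm, fun i t ht => ?_⟩
  set r : ℝ → ℝ := fun s =>
    ((fun s => κ ⌊s / h⌋₊ s) ⁻¹' {i}).indicator 1 s - w i s with hr
  have hAm : MeasurableSet ((fun s => κ ⌊s / h⌋₊ s) ⁻¹' {i}) := hκm (measurableSet_singleton i)
  have hrm : Measurable r := (measurable_one.indicator hAm).sub (hw i)
  have hr1 : ∀ s, |r s| ≤ 1 := by
    intro s
    have h1 := hw0 i s
    have h2 := (abs_le.1 (hwle i s)).2
    simp only [hr, indicator_apply, Pi.one_apply]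
    split_ifs <;> rw [abs_le] <;> constructor <;> linarith
  have hrint : ∀ a c, IntervalIntegrable r volume a c := fun a c =>
    ⟨integrableOn_of_abs_le_one hrm hr1 (by simp), integrableOn_of_abs_le_one hrm hr1 (by simp)⟩
  have hcell : ∀ k : ℕ, ∫ s in (k * h)..(k * h + h), r s = 0 := by
    intro k
    rw [intervalIntegral.integral_of_le (by linarith), ← integral_Ico_eq_integral_Ioc]
    simp only [hr]
    rw [integral_sub _ (hwint i _ _)]
    · rw [integral_indicator_one hAm, measureReal_restrict_apply hAm, sub_eq_zero]
      change _ = l k i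
      rw [← hκl k i]
      congr 1
      ext s
      simp only [mem_inter_iff, mem_preimage, mem_singleton_iff]
      refine and_congr_left fun hs => ?_
      have : ⌊s / h⌋₊ = k := by
        rw [Nat.floor_eq_iff (div_nonneg (le_trans (by positivity) hs.1) hh.le), le_div_iff₀ hh,
          div_lt_iff₀ hh]
        exact ⟨hs.1, by linarith [hs.2]⟩
      rw [this]
    · exact integrableOn_of_abs_le_one (measurable_one.indicator hAm)
        (fun s => by simp only [indicator_apply]; split_ifs <;> simp) (by simp)
  have hmesh : ∀ k : ℕ, ∫ s in (0 : ℝ)..(k * h), r s = 0 := by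
    intro k
    induction k with
    | zero => simp
    | succ k ih =>
      have := intervalIntegral.integral_add_adjacent_intervals (hrint 0 (k * h))
        (hrint (k * h) (k * h + h))
      rw [ih, hcell, add_zero] at this
      push_cast
      rw [add_mul, one_mul, ← this]
  rw [← intervalIntegral.integral_of_le ht]
  have hk1 : (⌊t / h⌋₊ : ℝ) * h ≤ t := by
    rw [← le_div_iff₀ hh]; exact Nat.floor_le (div_nonneg ht hh.le)
  have hk2 : t < ⌊t / h⌋₊ * h + h := by
    have := Nat.lt_floor_add_one (t / h)
    rw [div_lt_iff₀ hh] at this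
    linarith
  rw [← intervalIntegral.integral_add_adjacent_intervals (hrint 0 (⌊t / h⌋₊ * h)) (hrint _ t),
    hmesh, zero_add, ← Real.norm_eq_abs]
  refine (intervalIntegral.norm_integral_le_of_norm_le_const (C := 1) fun s _ => hr1 s).trans ?_
  rw [abs_of_nonneg (by linarith)]
  linarith

section Oscillation

variable {E : Type*} [NormedAddCommGroup E] [NormedSpace ℝ E]

/-- The primitives of `r n • f` tend to zero uniformly on `[0, b]`. -/
def PrimitivesVanish (b : ℝ) (r : ℕ → ℝ → ℝ) (f : ℝ → E) : Prop :=
  ∀ ε > (0 : ℝ), ∀ᶠ n in atTop, ∀ t ∈ Icc 0 b, ‖∫ s in Ioc 0 t, r n s • f s‖ ≤ ε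

variable {b : ℝ} {r : ℕ → ℝ → ℝ}

lemma integrableOn_smul_of_abs_le_one {r : ℝ → ℝ} (hr : Measurable r) (hr1 : ∀ s, |r s| ≤ 1)
    {f : ℝ → E} {A : Set ℝ} (hf : IntegrableOn f A) : IntegrableOn (fun s => r s • f s) A :=
  hf.bdd_smul 1 hr.aestronglyMeasurable (Eventually.of_forall hr1)

lemma PrimitivesVanish.add (hr : ∀ n, Measurable (r n)) (hr1 : ∀ n s, |r n s| ≤ 1)
    {f g : ℝ → E} (hf : IntegrableOn f (Ioc 0 b)) (hg : IntegrableOn g (Ioc 0 b))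
    (hPf : PrimitivesVanish b r f) (hPg : PrimitivesVanish b r g) :
    PrimitivesVanish b r (f + g) := by
  intro ε hε
  filter_upwards [hPf (ε / 2) (by positivity), hPg (ε / 2) (by positivity)] with n h1 h2 t ht
  have hsub : Ioc 0 t ⊆ Ioc 0 b := Ioc_subset_Ioc_right ht.2
  simp only [Pi.add_apply, smul_add]
  rw [integral_add (integrableOn_smul_of_abs_le_one (hr n) (hr1 n) (hf.mono_set hsub))
    (integrableOn_smul_of_abs_le_one (hr n) (hr1 n) (hg.mono_set hsub))]
  linarith [norm_add_le (∫ s in Ioc 0 t, r n s • f s) (∫ s in Ioc 0 t, r n s • g s),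
    h1 t ht, h2 t ht]

lemma PrimitivesVanish.of_approx (hr : ∀ n, Measurable (r n)) (hr1 : ∀ n s, |r n s| ≤ 1)
    {f : ℝ → E} (hf : IntegrableOn f (Ioc 0 b))
    (happ : ∀ ε > (0 : ℝ), ∃ g : ℝ → E, IntegrableOn g (Ioc 0 b) ∧ PrimitivesVanish b r g ∧
      ∫ s in Ioc 0 b, ‖f s - g s‖ ≤ ε) :
    PrimitivesVanish b r f := by
  intro ε hε
  obtain ⟨g, hg, hPg, hfg⟩ := happ (ε / 2) (by positivity)
  filter_upwards [hPg (ε / 2) (by positivity)] with n h2 t ht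
  have hsub : Ioc 0 t ⊆ Ioc 0 b := Ioc_subset_Ioc_right ht.2
  have hd : IntegrableOn (fun s => f s - g s) (Ioc 0 b) := hf.sub hg
  have hsplit : ∫ s in Ioc 0 t, r n s • f s =
      (∫ s in Ioc 0 t, r n s • (f s - g s)) + ∫ s in Ioc 0 t, r n s • g s := by
    rw [← integral_add (integrableOn_smul_of_abs_le_one (hr n) (hr1 n) (hd.mono_set hsub))
      (integrableOn_smul_of_abs_le_one (hr n) (hr1 n) (hg.mono_set hsub))]
    simp [smul_sub]
  have hle : ‖∫ s in Ioc 0 t, r n s • (f s - g s)‖ ≤ ε / 2 := by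
    refine (norm_integral_le_integral_norm _).trans (le_trans ?_ hfg)
    refine le_trans (integral_mono (integrableOn_smul_of_abs_le_one (hr n) (hr1 n)
      (hd.mono_set hsub)).norm (hd.mono_set hsub).norm fun s => ?_)
      (setIntegral_mono_set hd.norm (Eventually.of_forall fun _ => norm_nonneg _)
        hsub.eventuallyLE)
    dsimp only
    rw [norm_smul]
    exact mul_le_of_le_one_left (norm_nonneg _) (hr1 n s)
  rw [hsplit]
  linarith [norm_add_le (∫ s in Ioc 0 t, r n s • (f s - g s)) (∫ s in Ioc 0 t, r n s • g s),
    h2 t ht]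

lemma primitivesVanish_zero : PrimitivesVanish b r (0 : ℝ → E) := by
  intro ε hε
  simp [hε.le]

lemma PrimitivesVanish.finsetSum {κ : Type*} (S : Finset κ) (hr : ∀ n, Measurable (r n))
    (hr1 : ∀ n s, |r n s| ≤ 1) {f : κ → ℝ → E} (hf : ∀ i, IntegrableOn (f i) (Ioc 0 b))
    (hP : ∀ i, PrimitivesVanish b r (f i)) :
    PrimitivesVanish b r (∑ i ∈ S, f i) := by
  classical
  induction S using Finset.induction with
  | empty => simpa using primitivesVanish_zero
  | insert j S hj ih =>
    rw [Finset.sum_insert hj]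
    exact (hP j).add hr hr1 (hf j) (integrable_finsetSum' S fun i _ => hf i) ih

variable [CompleteSpace E]

lemma primitivesVanish_indicator (hr : ∀ n, Measurable (r n)) (hr1 : ∀ n s, |r n s| ≤ 1)
    (hr0 : PrimitivesVanish b r (fun _ => (1 : ℝ))) (c : E) {A : Set ℝ} (hA : MeasurableSet A) :
    PrimitivesVanish b r (A.indicator fun _ => c) := by
  have hind : ∀ (c : E) {A : Set ℝ}, MeasurableSet A →
      IntegrableOn (A.indicator fun _ => c) (Ioc 0 b) := fun c A hA =>
    (integrable_const c).indicator hA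
  have hbase : ∀ (a : ℝ) (c : E), PrimitivesVanish b r ((Iic a).indicator fun _ => c) := by
    intro a c ε hε
    filter_upwards [hr0 (ε / (‖c‖ + 1)) (by positivity)] with n hn t ht
    have : (fun s => r n s • (Iic a).indicator (fun _ => c) s) =
        (Iic a).indicator (fun s => r n s • c) := by
      ext s; simp only [indicator_apply]; split_ifs <;> simp
    rw [this, setIntegral_indicator measurableSet_Iic, Ioc_inter_Iic, integral_smul_const, norm_smul]
    rcases le_or_gt 0 a with ha | ha
    · have h := hn (t ⊓ a) ⟨le_min ht.1 ha, (min_le_left _ _).trans ht.2⟩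
      simp only [smul_eq_mul, mul_one] at h
      calc _ ≤ ε / (‖c‖ + 1) * ‖c‖ := by gcongr
        _ ≤ ε / (‖c‖ + 1) * (‖c‖ + 1) := by gcongr; linarith
        _ = ε := by field_simp
    · rw [Ioc_eq_empty (by simp [ha.le])]
      simp [hε.le]
  revert c
  refine MeasurableSpace.induction_on_inter
    (C := fun A _ => ∀ c : E, PrimitivesVanish b r (A.indicator fun _ => c))
    (borel_eq_generateFrom_Iic ℝ ▸ (BorelSpace.measurable_eq (α := ℝ))) isPiSystem_Iic ?_ ?_ ?_ ?_ A hA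
  · intro c
    rw [indicator_empty]
    exact primitivesVanish_zero
  · rintro _ ⟨a, rfl⟩ c
    exact hbase a c
  · intro A hA ih c
    have hconst : PrimitivesVanish b r (fun _ => c) := by
      intro ε hε
      filter_upwards [hbase b c ε hε] with n hn t ht
      convert hn t ht using 2
      refine setIntegral_congr_fun measurableSet_Ioc fun s hs => ?_
      simp [hs.2.trans ht.2]
    have := hconst.add hr hr1 (integrable_const c) (hind (-c) hA) (ih (-c))
    convert this using 1
    ext s
    by_cases hs : s ∈ A <;> simp [hs]
  · intro F hdisj hF ih c
    have hU : MeasurableSet (⋃ i, F i) := MeasurableSet.iUnion hF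
    refine PrimitivesVanish.of_approx hr hr1 (hind c hU) fun ε hε => ?_
    have hfin : ∀ S : Finset ℕ, MeasurableSet (⋃ i ∈ S, F i) := fun S =>
      S.measurableSet_biUnion fun i _ => hF i
    have hlim : Tendsto (fun S : Finset ℕ => ∫ s in Ioc 0 b,
        ‖(⋃ i, F i).indicator (fun _ => c) s - (⋃ i ∈ S, F i).indicator (fun _ => c) s‖) atTop
        (𝓝 (∫ s in Ioc 0 b, 0)) := by
      refine tendsto_integral_filter_of_dominated_convergence (fun _ => ‖c‖ + ‖c‖) ?_ ?_ ?_ ?_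
      · exact Eventually.of_forall fun S => ((hind c hU).sub (hind c (hfin S))).norm.1
      · refine Eventually.of_forall fun S => Eventually.of_forall fun s => ?_
        rw [norm_norm]
        exact (norm_sub_le _ _).trans
          (add_le_add (norm_indicator_le_norm_self _ _) (norm_indicator_le_norm_self _ _))
      · exact integrable_const _
      · refine Eventually.of_forall fun s => ?_
        have h1 := (tendsto_indicator_biUnion_finset F (fun _ => c) s).mono_right (pure_le_nhds _)
        have h2 := (tendsto_const_nhds (x := (⋃ i, F i).indicator (fun _ => c) s)).sub h1
        simpa using h2.norm
    rw [integral_zero] at hlim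
    obtain ⟨S, hS⟩ := (hlim.eventually (ge_mem_nhds hε)).exists
    refine ⟨_, hind c (hfin S), ?_, hS⟩
    have := PrimitivesVanish.finsetSum S hr hr1 (fun i => hind c (hF i)) (fun i => ih i c)
    convert this using 1
    rw [Finset.indicator_biUnion _ _ fun i _ j _ hij => hdisj hij]
    ext s
    simp

/-- If the primitives of a bounded sequence tend uniformly to zero, so do the primitives of its
products with any fixed integrable function. -/
lemma primitivesVanish_of_integrableOn (hr : ∀ n, Measurable (r n)) (hr1 : ∀ n s, |r n s| ≤ 1)
    (hr0 : PrimitivesVanish b r (fun _ => (1 : ℝ))) {f : ℝ → E} (hf : IntegrableOn f (Ioc 0 b)) :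
    PrimitivesVanish b r f := by
  refine Integrable.induction (PrimitivesVanish b r) (fun c A hA _ =>
    primitivesVanish_indicator hr hr1 hr0 c hA) ?_ ?_ ?_ hf
  · exact fun f g _ hf hg hPf hPg => hPf.add hr hr1 hf hg hPg
  · refine isClosed_of_closure_subset fun f hf => ?_
    refine PrimitivesVanish.of_approx hr hr1 (L1.integrable_coeFn f) fun ε hε => ?_
    obtain ⟨g, hg, hfg⟩ := Metric.mem_closure_iff.1 hf ε hε
    refine ⟨g, L1.integrable_coeFn g, hg, ?_⟩
    rw [L1.dist_eq_integral_dist] at hfg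
    simpa [dist_eq_norm] using hfg.le
  · intro f g hfg _ hPf ε hε
    filter_upwards [hPf ε hε] with n hn t ht
    convert hn t ht using 2
    refine setIntegral_congr_ae measurableSet_Ioc ?_
    have := (ae_restrict_iff' measurableSet_Ioc).1 hfg
    filter_upwards [this] with s hs hst
    rw [hs ⟨hst.1, hst.2.trans ht.2⟩]

end Oscillation

lemma intervalIntegrable_of_Icc {F : Type*} [NormedAddCommGroup F] {a b : ℝ} {u : ℝ → F}
    (hu : IntegrableOn u (Icc a b)) {x y : ℝ} (hx : x ∈ Icc a b) (hy : y ∈ Icc a b) :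
    IntervalIntegrable u volume x y :=
  (hu.mono_set (ordConnected_Icc.uIcc_subset hx hy)).intervalIntegrable

section Selections

variable {E : Type*} [NormedAddCommGroup E]

/-- Integrable selections on `[0, b]` of a set-valued map. -/
def IsIntegrableSelection (b : ℝ) (G : ℝ → Set E) (g : ℝ → E) : Prop :=
  IntegrableOn g (Icc 0 b) ∧ ∀ᵐ t ∂(volume.restrict (Icc (0 : ℝ) b)), g t ∈ G t

lemma IsIntegrableSelection.piecewise {b : ℝ} {G : ℝ → Set E} {g h : ℝ → E} {A : Set ℝ}
    [∀ t, Decidable (t ∈ A)] (hA : MeasurableSet A) (hg : IsIntegrableSelection b G g)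
    (hh : IsIntegrableSelection b G h) : IsIntegrableSelection b G (A.piecewise g h) := by
  refine ⟨Integrable.piecewise hA hg.1.integrableOn hh.1.integrableOn, ?_⟩
  filter_upwards [hg.2, hh.2] with t h1 h2
  by_cases ht : t ∈ A <;> simp [ht, h1, h2]

lemma exists_integral_norm_le {b : ℝ} (hb : 0 < b) {G : ℝ → Set E}
    (hui : ∀ ε > (0 : ℝ), ∃ δ > (0 : ℝ), ∀ g : ℝ → E, IsIntegrableSelection b G g →
      ∀ A : Set ℝ, MeasurableSet A → A ⊆ Icc (0 : ℝ) b → volume A < ENNReal.ofReal δ →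
        ∫ t in A, ‖g t‖ < ε) :
    ∃ M : ℝ, ∀ g, IsIntegrableSelection b G g → ∫ t in Icc 0 b, ‖g t‖ ≤ M := by
  obtain ⟨δ, hδ, hui⟩ := hui 1 one_pos
  obtain ⟨N, hN⟩ := exists_nat_gt (b / δ)
  have hN0 : (0 : ℝ) < N := (div_pos hb hδ).trans hN
  set h : ℝ := b / N with hh
  have hh0 : 0 < h := div_pos hb hN0
  have hhδ : h < δ := by rw [hh, div_lt_comm₀ hN0 hδ]; exact hN
  have hNh : N * h = b := by rw [hh]; field_simp
  refine ⟨N, fun g hg => ?_⟩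
  have hgn : IntegrableOn (fun t => ‖g t‖) (Icc 0 b) := hg.1.norm
  have hmem : ∀ k : ℕ, k ≤ N → (k : ℝ) * h ∈ Icc 0 b := fun k hk =>
    ⟨by positivity, by rw [← hNh]; gcongr⟩
  have key : ∀ k : ℕ, k ≤ N → ∫ t in (0 : ℝ)..(k * h), ‖g t‖ ≤ k := by
    intro k
    induction k with
    | zero => intro; simp
    | succ k ih =>
      intro hk
      have h1 := hmem k (by omega)
      have h2 := hmem (k + 1) hk
      have hle : (k : ℝ) * h ≤ ((k + 1 : ℕ) : ℝ) * h := by gcongr; simp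
      rw [← intervalIntegral.integral_add_adjacent_intervals
        (intervalIntegrable_of_Icc hgn ⟨le_rfl, hb.le⟩ h1) (intervalIntegrable_of_Icc hgn h1 h2)]
      have h3 : ∫ t in (k * h : ℝ)..(((k + 1 : ℕ) : ℝ) * h), ‖g t‖ < 1 := by
        rw [intervalIntegral.integral_of_le hle]
        refine hui g hg _ measurableSet_Ioc
          (Ioc_subset_Icc_self.trans (Icc_subset_Icc h1.1 h2.2)) ?_
        rw [Real.volume_Ioc, ENNReal.ofReal_lt_ofReal_iff hδ]
        push_cast
        linarith
      have := ih (by omega)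
      push_cast at h3 ⊢
      linarith
  have := key N le_rfl
  rwa [hNh, intervalIntegral.integral_of_le hb.le, ← integral_Icc_eq_integral_Ioc] at this

lemma IsIntegrableSelection.of_measurable [MeasurableSpace E] [BorelSpace E]
    [SecondCountableTopology E] {b M : ℝ} {G : ℝ → Set E} {g₀ u : ℝ → E}
    (hg₀ : IsIntegrableSelection b G g₀)
    (hM : ∀ g, IsIntegrableSelection b G g → ∫ t in Icc 0 b, ‖g t‖ ≤ M)
    (hu : Measurable u) (huG : ∀ᵐ t ∂(volume.restrict (Icc (0 : ℝ) b)), u t ∈ G t) :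
    IsIntegrableSelection b G u := by
  classical
  refine ⟨?_, huG⟩
  let A : ℕ → Set ℝ := fun n => {t | ‖u t‖ ≤ n}
  have hA : ∀ n, MeasurableSet (A n) := fun n => measurableSet_le hu.norm measurable_const
  have hsel : ∀ n, IsIntegrableSelection b G ((A n).piecewise u g₀) := by
    intro n
    refine ⟨Integrable.piecewise (hA n) ?_ hg₀.1.integrableOn, ?_⟩
    · refine Measure.integrableOn_of_bounded (M := n) ?_ hu.aestronglyMeasurable ?_
      · exact measure_ne_top _ _
      · exact (ae_restrict_iff' (hA n)).2 (Eventually.of_forall fun t ht => ht)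
    · filter_upwards [huG, hg₀.2] with t h1 h2
      by_cases ht : t ∈ A n <;> simp [ht, h1, h2]
  have hnorm : Integrable (fun t => ‖u t‖) (volume.restrict (Icc 0 b)) := by
    refine integrable_of_tendsto (G := fun n t => ‖(A n).piecewise u g₀ t‖) ?_
      (fun n => (hsel n).1.norm.1) ?_
    · refine Eventually.of_forall fun t => ?_
      refine tendsto_const_nhds.congr' ?_
      filter_upwards [eventually_ge_atTop ⌈‖u t‖⌉₊] with n hn
      have : t ∈ A n := (Nat.le_ceil ‖u t‖).trans (Nat.cast_le.2 hn)
      simp [this]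
    · refine ((liminf_le_of_frequently_le' (Frequently.of_forall fun n => ?_)).trans_lt
        (ENNReal.ofReal_lt_top (r := M))).ne
      simp only [enorm_norm]
      rw [← ofReal_integral_norm_eq_lintegral_enorm (hsel n).1]
      exact ENNReal.ofReal_le_ofReal (hM _ (hsel n))
  exact (integrable_norm_iff hu.aestronglyMeasurable).1 hnorm

end Selections

lemma ae_nonneg_of_forall_intervalIntegral_nonneg {b : ℝ} (hb : 0 < b) {k : ℝ → ℝ}
    (hk : IntegrableOn k (Icc 0 b))
    (h : ∀ s ∈ Icc 0 b, ∀ t ∈ Icc 0 b, s ≤ t → 0 ≤ ∫ x in s..t, k x) :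
    ∀ᵐ t ∂(volume.restrict (Icc (0 : ℝ) b)), 0 ≤ k t := by
  have h0 : (0 : ℝ) ∈ Icc 0 b := ⟨le_rfl, hb.le⟩
  rw [ae_restrict_iff' measurableSet_Icc]
  filter_upwards [(intervalIntegrable_of_Icc hk h0 ⟨hb.le, le_rfl⟩).ae_hasDerivAt_integral] with x hx hxb
  have hd := hx (by rwa [uIcc_of_le hb.le]) 0 (by rwa [uIcc_of_le hb.le])
  refine (hd.hasDerivWithinAt (s := Icc 0 b)).nonneg_of_monotoneOn
    ((uniqueDiffOn_Icc hb) x hxb).accPt ?_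
  intro s hs t ht hst
  dsimp only
  rw [← intervalIntegral.integral_add_adjacent_intervals (intervalIntegrable_of_Icc hk h0 hs)
    (intervalIntegrable_of_Icc hk hs ht)]
  linarith [h s hs t ht hst]

section ConvexHull

variable {E : Type*} [NormedAddCommGroup E] [InnerProductSpace ℝ E] [FiniteDimensional ℝ E]

open scoped InnerProductSpace

lemma exists_fin_convex_combination {K : Set E} {x : E} (hx : x ∈ convexHull ℝ K) :
    ∃ (w : Fin (Module.finrank ℝ E + 1) → ℝ) (v : Fin (Module.finrank ℝ E + 1) → E),
      (∀ i, 0 ≤ w i) ∧ ∑ i, w i = 1 ∧ (∀ i, v i ∈ K) ∧ ∑ i, w i • v i = x := by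
  classical
  obtain ⟨ι, _, z, w, hz, hind, hw, hsum, hx⟩ := eq_pos_convex_span_of_mem_convexHull hx
  have hcard : Fintype.card ι ≤ Fintype.card (Fin (Module.finrank ℝ E + 1)) := by
    rw [Fintype.card_fin]
    exact hind.card_le_finrank_succ.trans (Nat.add_le_add_right (Submodule.finrank_le _) 1)
  obtain ⟨e⟩ := Function.Embedding.nonempty_of_card_le hcard
  have hne : Nonempty ι := by
    by_contra hne
    rw [not_nonempty_iff] at hne
    simp at hsum
  obtain ⟨i₀⟩ := hne
  have hout : ∀ j ∉ range e, Function.extend e w 0 j = 0 := fun j hj =>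
    Function.extend_apply' _ _ _ fun ⟨i, hi⟩ => hj ⟨i, hi⟩
  refine ⟨Function.extend e w 0, Function.extend e z fun _ => z i₀, ?_, ?_, ?_, ?_⟩
  · intro j
    by_cases hj : j ∈ range e
    · obtain ⟨i, rfl⟩ := hj
      rw [e.injective.extend_apply]
      exact (hw i).le
    · rw [hout j hj]
  · rw [← hsum]
    refine (Fintype.sum_of_injective e e.injective _ _ hout fun i => ?_).symm
    rw [e.injective.extend_apply]
  · intro j
    by_cases hj : j ∈ range e
    · obtain ⟨i, rfl⟩ := hj
      rw [e.injective.extend_apply]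
      exact hz ⟨i, rfl⟩
    · rw [Function.extend_apply' _ _ _ fun ⟨i, hi⟩ => hj ⟨i, hi⟩]
      exact hz ⟨i₀, rfl⟩
  · rw [← hx]
    refine (Fintype.sum_of_injective e e.injective _ _ (fun j hj => ?_) fun i => ?_).symm
    · rw [hout j hj, zero_smul]
    · rw [e.injective.extend_apply, e.injective.extend_apply]

lemma IsCompact.isClosed_convexHull {K : Set E} (hK : IsCompact K) :
    IsClosed (convexHull ℝ K) := by
  let ι := Fin (Module.finrank ℝ E + 1)
  have hP : IsCompact (stdSimplex ℝ ι ×ˢ univ.pi fun _ : ι => K) :=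
    (isCompact_stdSimplex ℝ ι).prod (isCompact_univ_pi fun _ => hK)
  have hcont : Continuous fun p : (ι → ℝ) × (ι → E) => ∑ i, p.1 i • p.2 i := by fun_prop
  convert (hP.image hcont).isClosed using 1
  ext x
  constructor
  · intro hx
    obtain ⟨w, v, hw, hsum, hv, rfl⟩ := exists_fin_convex_combination hx
    exact ⟨(w, v), ⟨⟨hw, hsum⟩, fun i _ => hv i⟩, rfl⟩
  · rintro ⟨⟨w, v⟩, ⟨⟨hw, hsum⟩, hv⟩, rfl⟩
    exact (convex_convexHull ℝ K).sum_mem (fun i _ => hw i) hsum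
      fun i _ => subset_convexHull ℝ K (hv i (mem_univ i))

lemma mem_convexHull_of_forall_denseSeq_inner_le {K : Set E} (hK : IsCompact K) {x : E}
    (h : ∀ n : ℕ, ∃ v ∈ K, ⟪TopologicalSpace.denseSeq E n, x⟫_ℝ ≤
      ⟪TopologicalSpace.denseSeq E n, v⟫_ℝ) :
    x ∈ convexHull ℝ K := by
  by_contra hx
  obtain ⟨φ, c, hφK, hφx⟩ := geometric_hahn_banach_closed_point (convex_convexHull ℝ K)
    hK.isClosed_convexHull hx
  set p := (InnerProductSpace.toDual ℝ E).symm φ with hp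
  have hφ : ∀ v, φ v = ⟪p, v⟫_ℝ := fun v => by
    rw [hp, InnerProductSpace.toDual_symm_apply]
  obtain ⟨R, hR⟩ := (hK.isBounded.sub (Bornology.isBounded_singleton (x := x))).exists_norm_le
  have hgap : 0 < (φ x - c) / (|R| + 1) := div_pos (sub_pos.2 hφx) (by positivity)
  obtain ⟨n, hn⟩ := (TopologicalSpace.denseRange_denseSeq E).exists_dist_lt p hgap
  obtain ⟨v, hvK, hv⟩ := h n
  set q := TopologicalSpace.denseSeq E n
  have h1 : ‖v - x‖ ≤ |R| + 1 :=
    (hR _ (sub_mem_sub hvK rfl)).trans (by linarith [le_abs_self R])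
  have h2 : ⟪q - p, v - x⟫_ℝ ≤ ‖q - p‖ * ‖v - x‖ := real_inner_le_norm _ _
  have h3 : ‖q - p‖ * ‖v - x‖ ≤ φ x - c := by
    rw [dist_comm, dist_eq_norm] at hn
    calc _ ≤ (φ x - c) / (|R| + 1) * (|R| + 1) := by gcongr
      _ = _ := by field_simp
  have h4 := hφK v (subset_convexHull ℝ K hvK)
  rw [hφ] at h3 h4 hφx
  simp only [inner_sub_left, inner_sub_right] at h2
  linarith

end ConvexHull

section Graph

variable {Y : Type*} [mY : MeasurableSpace Y]

/-- A set in the product of the Lebesgue `σ`-algebra with a `σ`-algebra agrees, off a null set of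
fibres, with a set in the product of the Borel `σ`-algebra. -/
lemma exists_measurableSet_ae_fiber_iff {A : Set (ℝ × Y)}
    (hA : MeasurableSet[lebesgueSigmaAlgebra.prod mY] A) :
    ∃ B : Set (ℝ × Y), MeasurableSet B ∧ ∀ᵐ t : ℝ, ∀ y, (t, y) ∈ A ↔ (t, y) ∈ B := by
  let m : MeasurableSpace (ℝ × Y) :=
    { MeasurableSet' := fun A => ∃ B : Set (ℝ × Y), MeasurableSet B ∧
        ∀ᵐ t : ℝ, ∀ y, (t, y) ∈ A ↔ (t, y) ∈ B
      measurableSet_empty := ⟨∅, MeasurableSet.empty, by simp⟩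
      measurableSet_compl := by
        rintro A ⟨B, hB, hAB⟩
        exact ⟨Bᶜ, hB.compl, hAB.mono fun t ht y => not_congr (ht y)⟩
      measurableSet_iUnion := by
        intro A hA
        choose B hB hAB using hA
        refine ⟨⋃ n, B n, MeasurableSet.iUnion hB, ?_⟩
        filter_upwards [ae_all_iff.2 hAB] with t ht y
        simp only [mem_iUnion, ht] }
  have hle : lebesgueSigmaAlgebra.prod mY ≤ m := by
    refine sup_le ?_ ?_
    · rintro _ ⟨S, hS, rfl⟩
      have hS' : NullMeasurableSet S volume := hS
      refine ⟨Prod.fst ⁻¹' toMeasurable volume S,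
        measurable_fst (measurableSet_toMeasurable _ _), ?_⟩
      filter_upwards [hS'.toMeasurable_ae_eq.mem_iff] with t ht y
      exact ht.symm
    · rintro _ ⟨S, hS, rfl⟩
      exact ⟨Prod.snd ⁻¹' S, measurable_snd hS, by simp⟩
  exact hle A hA

end Graph

lemma norm_intervalIntegral_le_weakNorm {E : Type*} [NormedAddCommGroup E] [NormedSpace ℝ E]
    {b : ℝ} {v : ℝ → E} (hv : IntegrableOn v (Icc 0 b)) {t : ℝ} (ht : t ∈ Icc 0 b) :
    ‖∫ s in (0 : ℝ)..t, v s‖ ≤ weakNorm b v := by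
  refine le_ciSup (f := fun t : Icc (0 : ℝ) b => ‖∫ s in (0 : ℝ)..(t : ℝ), v s‖) ?_ ⟨t, ht⟩
  refine ⟨∫ s in Icc 0 b, ‖v s‖, ?_⟩
  rintro _ ⟨s, rfl⟩
  dsimp only
  rw [intervalIntegral.integral_of_le s.2.1]
  exact (norm_integral_le_integral_norm _).trans
    (setIntegral_mono_set hv.norm (Eventually.of_forall fun _ => norm_nonneg _)
      (Ioc_subset_Icc_self.trans (Icc_subset_Icc_right s.2.2)).eventuallyLE)

section Closure

open scoped InnerProductSpace

variable {E : Type*} [NormedAddCommGroup E] [InnerProductSpace ℝ E] [FiniteDimensional ℝ E]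
  [MeasurableSpace E] [BorelSpace E] {b M : ℝ} {G : ℝ → Set E} {f : ℝ → E}

lemma ae_exists_inner_le_of_tendsto_integral (hb : 0 < b) (hne : ∀ t, (G t).Nonempty)
    (hcpt : ∀ t, IsCompact (G t))
    (hM : ∀ g, IsIntegrableSelection b G g → ∫ t in Icc 0 b, ‖g t‖ ≤ M)
    (hf : IntegrableOn f (Icc 0 b)) {g : ℕ → ℝ → E} (hgm : ∀ n, Measurable (g n))
    (hg : ∀ n, IsIntegrableSelection b G (g n))
    (hlim : ∀ t ∈ Icc 0 b, Tendsto (fun n => ∫ s in (0 : ℝ)..t, g n s) atTop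
      (𝓝 (∫ s in (0 : ℝ)..t, f s))) (p : E) :
    ∀ᵐ t ∂(volume.restrict (Icc (0 : ℝ) b)), ∃ v ∈ G t, ⟪p, f t⟫_ℝ ≤ ⟪p, v⟫_ℝ := by
  classical
  let A : (ℝ → E) → ℕ → Set ℝ := fun u n => {t | ⟪p, u t⟫_ℝ < ⟪p, g n t⟫_ℝ}
  let W : ℕ → ℝ → E := fun n => Nat.rec (g 0) (fun n u => (A u (n + 1)).piecewise (g (n + 1)) u) n
  have hWs : ∀ n, W (n + 1) = (A (W n) (n + 1)).piecewise (g (n + 1)) (W n) := fun n => rfl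
  have hA : ∀ u : ℝ → E, Measurable u → ∀ n, MeasurableSet (A u n) := fun u hu n =>
    measurableSet_lt (hu.const_inner) ((hgm n).const_inner)
  have hWm : ∀ n, Measurable (W n) := by
    intro n
    induction n with
    | zero => exact hgm 0
    | succ n ih => rw [hWs]; exact (hgm _).piecewise (hA _ ih _) ih
  have hWsel : ∀ n, IsIntegrableSelection b G (W n) := by
    intro n
    induction n with
    | zero => exact hg 0
    | succ n ih => rw [hWs]; exact (hg _).piecewise (hA _ (hWm n) _) ih
  let a : ℕ → ℝ → ℝ := fun n t => ⟪p, W n t⟫_ℝ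
  have hstep : ∀ n t, a n t ≤ a (n + 1) t ∧ ⟪p, g (n + 1) t⟫_ℝ ≤ a (n + 1) t := by
    intro n t
    simp only [a, hWs]
    by_cases ht : t ∈ A (W n) (n + 1)
    · rw [piecewise_eq_of_mem _ _ _ ht]
      exact ⟨le_of_lt ht, le_rfl⟩
    · rw [piecewise_eq_of_notMem _ _ _ ht]
      exact ⟨le_rfl, not_lt.1 ht⟩
  have hmono : ∀ t, Monotone fun n => a n t := fun t => monotone_nat_of_le_succ fun n => (hstep n t).1
  have hga : ∀ n t, ⟪p, g n t⟫_ℝ ≤ a n t := by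
    intro n t
    cases n with
    | zero => exact le_rfl
    | succ n => exact (hstep n t).2
  have haI : ∀ n, IntegrableOn (a n) (Icc 0 b) := fun n => (hWsel n).1.const_inner p
  have hmax : ∀ t, ∃ v ∈ G t, ∀ w ∈ G t, ⟪p, w⟫_ℝ ≤ ⟪p, v⟫_ℝ := fun t =>
    (hcpt t).exists_isMaxOn (hne t) (by fun_prop : Continuous fun v : E => ⟪p, v⟫_ℝ).continuousOn
  choose v hvG hv using hmax
  have hWG : ∀ᵐ t ∂(volume.restrict (Icc (0 : ℝ) b)), ∀ n, W n t ∈ G t :=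
    ae_all_iff.2 fun n => (hWsel n).2
  let h : ℝ → ℝ := fun t => ⨆ n, a n t
  have hbdd : ∀ᵐ t ∂(volume.restrict (Icc (0 : ℝ) b)), BddAbove (range fun n => a n t) := by
    filter_upwards [hWG] with t ht
    exact ⟨⟪p, v t⟫_ℝ, by rintro _ ⟨n, rfl⟩; exact hv t _ (ht n)⟩
  have hlimh : ∀ᵐ t ∂(volume.restrict (Icc (0 : ℝ) b)), Tendsto (fun n => a n t) atTop (𝓝 (h t)) := by
    filter_upwards [hbdd] with t ht
    exact tendsto_atTop_ciSup (hmono t) ht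
  have hhI : IntegrableOn h (Icc 0 b) := by
    refine integrable_of_tendsto hlimh (fun n => (haI n).1) ?_
    refine ((liminf_le_of_frequently_le' (Frequently.of_forall fun n => ?_)).trans_lt
      (ENNReal.ofReal_lt_top (r := ‖p‖ * M))).ne
    rw [← ofReal_integral_norm_eq_lintegral_enorm (haI n)]
    refine ENNReal.ofReal_le_ofReal ?_
    calc ∫ t in Icc 0 b, ‖a n t‖ ≤ ∫ t in Icc 0 b, ‖p‖ * ‖W n t‖ :=
          integral_mono (haI n).norm ((hWsel n).1.norm.const_mul _)
            fun t => norm_inner_le_norm p (W n t)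
      _ = ‖p‖ * ∫ t in Icc 0 b, ‖W n t‖ := integral_const_mul _ _
      _ ≤ ‖p‖ * M := by gcongr; exact hM _ (hWsel n)
  have hgI : ∀ n, IntegrableOn (fun t => ⟪p, g n t⟫_ℝ) (Icc 0 b) := fun n => (hg n).1.const_inner p
  have hfI : IntegrableOn (fun t => ⟪p, f t⟫_ℝ) (Icc 0 b) := hf.const_inner p
  have hk := ae_nonneg_of_forall_intervalIntegral_nonneg hb (k := fun t => h t - ⟪p, f t⟫_ℝ)
    (hhI.sub hfI) ?_
  · filter_upwards [hk, hWG] with t ht hWt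
    refine ⟨v t, hvG t, (sub_nonneg.1 ht).trans (ciSup_le fun n => hv t _ (hWt n))⟩
  intro s hs t ht hst
  have hsub : uIcc s t ⊆ Icc 0 b := by
    rw [uIcc_of_le hst]; exact Icc_subset_Icc hs.1 ht.2
  have h0 : (0 : ℝ) ∈ Icc 0 b := ⟨le_rfl, hb.le⟩
  have hlimst : Tendsto (fun n => ∫ x in s..t, g n x) atTop (𝓝 (∫ x in s..t, f x)) := by
    have h1 := (hlim t ht).sub (hlim s hs)
    rw [intervalIntegral.integral_interval_sub_left (intervalIntegrable_of_Icc hf h0 ht)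
      (intervalIntegrable_of_Icc hf h0 hs)] at h1
    refine h1.congr fun n => ?_
    rw [intervalIntegral.integral_interval_sub_left (intervalIntegrable_of_Icc (hg n).1 h0 ht)
      (intervalIntegrable_of_Icc (hg n).1 h0 hs)]
  have hinner : ∀ {u : ℝ → E}, IntegrableOn u (Icc 0 b) →
      ∫ x in s..t, ⟪p, u x⟫_ℝ = ⟪p, ∫ x in s..t, u x⟫_ℝ := fun hu =>
    (innerSL ℝ p).intervalIntegral_comp_comm (intervalIntegrable_of_Icc hu hs ht)
  rw [intervalIntegral.integral_sub (intervalIntegrable_of_Icc hhI hs ht)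
    (intervalIntegrable_of_Icc hfI hs ht), sub_nonneg, hinner hf]
  refine le_of_tendsto ((tendsto_const_nhds (x := p)).inner hlimst) (Eventually.of_forall fun n => ?_)
  rw [← hinner (hg n).1]
  refine intervalIntegral.integral_mono_ae_restrict hst
    (intervalIntegrable_of_Icc (hgI n) hs ht) (intervalIntegrable_of_Icc hhI hs ht) ?_
  have hbdd' := ae_mono (Measure.restrict_mono (μ := volume) ((uIcc_of_le hst) ▸ hsub) le_rfl) hbdd
  filter_upwards [hbdd'] with x hx
  exact (hga n x).trans (le_ciSup hx n)

lemma ae_mem_convexHull_of_tendsto_weakNorm (hb : 0 < b) (hne : ∀ t, (G t).Nonempty)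
    (hcpt : ∀ t, IsCompact (G t))
    (hM : ∀ g, IsIntegrableSelection b G g → ∫ t in Icc 0 b, ‖g t‖ ≤ M)
    (hf : IntegrableOn f (Icc 0 b)) {g : ℕ → ℝ → E} (hg : ∀ n, IsIntegrableSelection b G (g n))
    (hlim : Tendsto (fun n => weakNorm b fun s => g n s - f s) atTop (𝓝 0)) :
    ∀ᵐ t ∂(volume.restrict (Icc (0 : ℝ) b)), f t ∈ convexHull ℝ (G t) := by
  let g' : ℕ → ℝ → E := fun n => (hg n).1.1.mk (g n)
  have hgg' : ∀ n, g n =ᵐ[volume.restrict (Icc 0 b)] g' n := fun n => (hg n).1.1.ae_eq_mk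
  have hg'm : ∀ n, Measurable (g' n) := fun n => (hg n).1.1.measurable_mk
  have hg' : ∀ n, IsIntegrableSelection b G (g' n) := fun n => by
    refine ⟨(hg n).1.congr (hgg' n), ?_⟩
    filter_upwards [hgg' n, (hg n).2] with t h1 h2
    rwa [← h1]
  have hlim' : ∀ t ∈ Icc 0 b, Tendsto (fun n => ∫ s in (0 : ℝ)..t, g' n s) atTop
      (𝓝 (∫ s in (0 : ℝ)..t, f s)) := by
    intro t ht
    have hsub : Ioc 0 t ⊆ Icc 0 b := Ioc_subset_Icc_self.trans (Icc_subset_Icc_right ht.2)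
    rw [tendsto_iff_norm_sub_tendsto_zero]
    refine squeeze_zero (fun _ => norm_nonneg _) (fun n => ?_) hlim
    have heq : ∫ s in (0 : ℝ)..t, g' n s = ∫ s in (0 : ℝ)..t, g n s := by
      rw [intervalIntegral.integral_of_le ht.1, intervalIntegral.integral_of_le ht.1]
      exact integral_congr_ae
        (EventuallyEq.symm (ae_mono (Measure.restrict_mono hsub le_rfl) (hgg' n)))
    rw [heq, ← intervalIntegral.integral_sub (intervalIntegrable_of_Icc (hg n).1 ⟨le_rfl, hb.le⟩ ht)
      (intervalIntegrable_of_Icc hf ⟨le_rfl, hb.le⟩ ht)]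
    exact norm_intervalIntegral_le_weakNorm ((hg n).1.sub hf) ht
  have := ae_all_iff.2 fun n : ℕ => ae_exists_inner_le_of_tendsto_integral hb hne hcpt hM hf hg'm hg'
    hlim' (TopologicalSpace.denseSeq E n)
  filter_upwards [this] with t ht
  exact mem_convexHull_of_forall_denseSeq_inner_le (hcpt t) ht

/-- A measurable Carathéodory decomposition of an integrable selection of the convex hull. -/
lemma exists_measurable_convex_combination
    (hgraph : MeasurableSet[lebesgueSigmaAlgebra.prod (inferInstance : MeasurableSpace E)]
      {p : ℝ × E | p.1 ∈ Icc (0 : ℝ) b ∧ p.2 ∈ G p.1})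
    (hf : IntegrableOn f (Icc 0 b))
    (hfG : ∀ᵐ t ∂(volume.restrict (Icc (0 : ℝ) b)), f t ∈ convexHull ℝ (G t)) :
    ∃ (w : Fin (Module.finrank ℝ E + 1) → ℝ → ℝ) (v : Fin (Module.finrank ℝ E + 1) → ℝ → E),
      (∀ i, Measurable (w i)) ∧ (∀ i, Measurable (v i)) ∧ (∀ i t, 0 ≤ w i t) ∧
      (∀ t, ∑ i, w i t = 1) ∧
      (∀ᵐ t ∂(volume.restrict (Icc (0 : ℝ) b)), ∀ i, v i t ∈ G t) ∧
      ∀ᵐ t ∂(volume.restrict (Icc (0 : ℝ) b)), ∑ i, w i t • v i t = f t := by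
  classical
  let ι := Fin (Module.finrank ℝ E + 1)
  obtain ⟨B, hB, hBG⟩ := exists_measurableSet_ae_fiber_iff hgraph
  replace hBG : ∀ᵐ t ∂(volume.restrict (Icc (0 : ℝ) b)), ∀ y, (t, y) ∈ B ↔ y ∈ G t := by
    filter_upwards [ae_restrict_of_ae hBG, ae_restrict_mem measurableSet_Icc] with t ht htb y
    rw [← ht y]
    exact and_iff_right htb
  let f' : ℝ → E := hf.1.mk f
  have hff' : f =ᵐ[volume.restrict (Icc 0 b)] f' := hf.1.ae_eq_mk
  have hf'm : Measurable f' := hf.1.measurable_mk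
  let D : Set (ℝ × ((ι → ℝ) × (ι → E))) :=
    {q | (∀ i, 0 ≤ q.2.1 i) ∧ ∑ i, q.2.1 i = 1 ∧ (∀ i, (q.1, q.2.2 i) ∈ B) ∧
      ∑ i, q.2.1 i • q.2.2 i = f' q.1}
  have hD : MeasurableSet D := by
    have h1 : MeasurableSet {q : ℝ × ((ι → ℝ) × (ι → E)) | ∀ i, 0 ≤ q.2.1 i} := by
      simp only [ofPred_forall]
      exact MeasurableSet.iInter fun i => measurableSet_le measurable_const (by fun_prop)
    have h2 : MeasurableSet {q : ℝ × ((ι → ℝ) × (ι → E)) | ∑ i, q.2.1 i = 1} :=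
      measurableSet_eq_fun (by fun_prop) measurable_const
    have h3 : MeasurableSet {q : ℝ × ((ι → ℝ) × (ι → E)) | ∀ i, (q.1, q.2.2 i) ∈ B} := by
      simp only [ofPred_forall]
      refine MeasurableSet.iInter fun i => ?_
      have : Measurable fun q : ℝ × ((ι → ℝ) × (ι → E)) => (q.1, q.2.2 i) := by fun_prop
      exact this hB
    have h4 : MeasurableSet {q : ℝ × ((ι → ℝ) × (ι → E)) | ∑ i, q.2.1 i • q.2.2 i = f' q.1} :=
      measurableSet_eq_fun (by fun_prop) (by fun_prop)
    exact h1.inter (h2.inter (h3.inter h4))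
  have hex : ∀ᵐ t ∂(volume.restrict (Icc (0 : ℝ) b)), ∃ y, (t, y) ∈ D := by
    filter_upwards [hfG, hBG, hff'] with t h1 h2 h3
    obtain ⟨w, v, hw, hsum, hv, hx⟩ := exists_fin_convex_combination h1
    exact ⟨(w, v), hw, hsum, fun i => (h2 _).2 (hv i), hx.trans h3⟩
  obtain ⟨u, hu, huD⟩ := exists_measurable_selection (volume.restrict (Icc 0 b)) hD hex
  let R : Set ℝ := {t | (t, u t) ∈ D}
  have hR : MeasurableSet R := (measurable_id.prodMk hu) hD
  refine ⟨fun i t => if t ∈ R then (u t).1 i else if i = 0 then 1 else 0, fun i t => (u t).2 i,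
    fun i => ?_, fun i => by fun_prop, fun i t => ?_, fun t => ?_, ?_, ?_⟩
  · exact Measurable.ite hR (by fun_prop) measurable_const
  · dsimp only
    split_ifs with h
    · exact h.1 i
    · exact zero_le_one
    · exact le_rfl
  · by_cases h : t ∈ R
    · simp only [h, if_true]
      exact h.2.1
    · simp [h]
  · filter_upwards [huD, hBG] with t h1 h2 i
    exact (h2 _).1 (h1.2.2.1 i)
  · filter_upwards [huD, hff'] with t h1 h2
    have h : t ∈ R := h1
    simp only [h, if_true]
    exact h1.2.2.2.trans h2.symm

lemma exists_tendsto_weakNorm_of_ae_mem_convexHull (hb : 0 < b)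
    (hgraph : MeasurableSet[lebesgueSigmaAlgebra.prod (inferInstance : MeasurableSpace E)]
      {p : ℝ × E | p.1 ∈ Icc (0 : ℝ) b ∧ p.2 ∈ G p.1})
    (hM : ∀ g, IsIntegrableSelection b G g → ∫ t in Icc 0 b, ‖g t‖ ≤ M)
    {g₀ : ℝ → E} (hg₀ : IsIntegrableSelection b G g₀) (hf : IntegrableOn f (Icc 0 b))
    (hfG : ∀ᵐ t ∂(volume.restrict (Icc (0 : ℝ) b)), f t ∈ convexHull ℝ (G t)) :
    ∃ g : ℕ → ℝ → E, (∀ n, IsIntegrableSelection b G (g n)) ∧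
      Tendsto (fun n => weakNorm b fun s => g n s - f s) atTop (𝓝 0) := by
  classical
  obtain ⟨w, v, hw, hv, hw0, hw1, hvG, hwv⟩ := exists_measurable_convex_combination hgraph hf hfG
  have hvsel : ∀ i, IsIntegrableSelection b G (v i) := fun i =>
    hg₀.of_measurable hM (hv i) (hvG.mono fun t ht => ht i)
  have hκ := fun n : ℕ => exists_measurable_index w hw hw0 hw1 (Nat.one_div_pos_of_nat (α := ℝ) (n := n))
  choose κ hκm hκ using hκ
  have hgm : ∀ n, Measurable fun t => v (κ n t) t := fun n => by
    have : Measurable fun p : ℝ × Fin (Module.finrank ℝ E + 1) => v p.2 p.1 :=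
      measurable_from_prod_countable_left hv
    exact this.comp (measurable_id.prodMk (hκm n))
  have hgsel : ∀ n, IsIntegrableSelection b G fun t => v (κ n t) t := fun n =>
    hg₀.of_measurable hM (hgm n) (hvG.mono fun t ht => ht _)
  let r : Fin (Module.finrank ℝ E + 1) → ℕ → ℝ → ℝ := fun i n s =>
    (κ n ⁻¹' {i}).indicator 1 s - w i s
  have hrm : ∀ i n, Measurable (r i n) := fun i n =>
    (measurable_one.indicator (hκm n (measurableSet_singleton i))).sub (hw i)
  have hr1 : ∀ i n s, |r i n s| ≤ 1 := by
    intro i n s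
    have h1 := hw0 i s
    have h2 : w i s ≤ 1 :=
      hw1 s ▸ Finset.single_le_sum (f := fun j => w j s) (fun j _ => hw0 j s) (Finset.mem_univ i)
    simp only [r, indicator_apply, Pi.one_apply]
    split_ifs <;> rw [abs_le] <;> constructor <;> linarith
  have hr0 : ∀ i, PrimitivesVanish b (r i) fun _ => (1 : ℝ) := by
    intro i ε hε
    filter_upwards [(tendsto_one_div_add_atTop_nhds_zero_nat (𝕜 := ℝ)).eventually
      (ge_mem_nhds hε)] with n hn t ht
    simp only [smul_eq_mul, mul_one]
    exact (hκ n i t ht.1).trans hn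
  have hvan : ∀ i, PrimitivesVanish b (r i) (v i) := fun i =>
    primitivesVanish_of_integrableOn (hrm i) (hr1 i) (hr0 i)
      ((hvsel i).1.mono_set Ioc_subset_Icc_self)
  refine ⟨fun n t => v (κ n t) t, hgsel, ?_⟩
  rw [Metric.tendsto_atTop']
  intro ε hε
  set m : ℝ := Module.finrank ℝ E + 1 with hm
  have hm0 : 0 < m := by positivity
  obtain ⟨N, hN⟩ := eventually_atTop.1
    (eventually_all.2 fun i => hvan i (ε / 2 / m) (by positivity))
  refine ⟨N, fun n hn => ?_⟩
  have hle : weakNorm b (fun s => v (κ n s) s - f s) ≤ ε / 2 := by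
    have : Nonempty (Icc (0 : ℝ) b) := ⟨⟨0, le_rfl, hb.le⟩⟩
    refine ciSup_le fun t => ?_
    have hsub : Ioc 0 (t : ℝ) ⊆ Icc 0 b :=
      Ioc_subset_Icc_self.trans (Icc_subset_Icc_right t.2.2)
    have heq : ∫ s in (0 : ℝ)..(t : ℝ), (v (κ n s) s - f s) =
        ∑ i, ∫ s in Ioc 0 (t : ℝ), r i n s • v i s := by
      rw [intervalIntegral.integral_of_le t.2.1, ← integral_finsetSum _ fun i _ =>
        integrableOn_smul_of_abs_le_one (hrm i n) (hr1 i n) ((hvsel i).1.mono_set hsub)]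
      refine integral_congr_ae ?_
      filter_upwards [ae_mono (Measure.restrict_mono hsub le_rfl) hwv] with s hs
      simp only [r, sub_smul, Finset.sum_sub_distrib, hs]
      congr 1
      rw [Finset.sum_eq_single (κ n s)]
      · simp
      · intro i _ hi
        simp [Ne.symm hi]
      · simp
    rw [heq]
    calc _ ≤ ∑ i, ‖∫ s in Ioc 0 (t : ℝ), r i n s • v i s‖ := norm_sum_le _ _
      _ ≤ ∑ _i : Fin (Module.finrank ℝ E + 1), ε / 2 / m :=
          Finset.sum_le_sum fun i _ => hN n (le_of_lt hn) i t t.2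
      _ = ε / 2 := by
          rw [Finset.sum_const, Finset.card_univ, Fintype.card_fin, nsmul_eq_mul]
          push_cast
          rw [← hm]
          field_simp
  have h0 : 0 ≤ weakNorm b (fun s => v (κ n s) s - f s) :=
    Real.iSup_nonneg fun _ => norm_nonneg _
  rw [Real.dist_eq, sub_zero, abs_of_nonneg h0]
  linarith

end Closure

/-- Proposition 3.5: if `G : T → P_k(ℝ^d)` is graph measurable and
`S¹_G = {g ∈ L¹ : g(t) ∈ G(t) a.e.}` is nonempty and uniformly integrable, then
the `‖·‖_w`-closure of `S¹_G` equals `S¹_{conv G}`: a function `f ∈ L¹`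
satisfies `f(t) ∈ conv G(t)` a.e. iff it is a `‖·‖_w`-limit of selections of `G`. -/
theorem weak_norm_closure_of_selections_eq_selections_of_convexHull
    (d : ℕ) (b : ℝ) (hb : 0 < b)
    (G : ℝ → Set (EuclideanSpace ℝ (Fin d)))
    (hG_ne : ∀ t, (G t).Nonempty) (hG_cpt : ∀ t, IsCompact (G t))
    (hG_graph : MeasurableSet[lebesgueSigmaAlgebra.prod
        (inferInstance : MeasurableSpace (EuclideanSpace ℝ (Fin d)))]
      {p : ℝ × EuclideanSpace ℝ (Fin d) | p.1 ∈ Icc (0:ℝ) b ∧ p.2 ∈ G p.1})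
    (hS_ne : ∃ g : ℝ → EuclideanSpace ℝ (Fin d), IntegrableOn g (Icc 0 b) ∧
      ∀ᵐ t ∂(volume.restrict (Icc (0:ℝ) b)), g t ∈ G t)
    (hS_ui : ∀ ε > (0:ℝ), ∃ δ > (0:ℝ), ∀ g : ℝ → EuclideanSpace ℝ (Fin d),
      (IntegrableOn g (Icc 0 b) ∧ ∀ᵐ t ∂(volume.restrict (Icc (0:ℝ) b)), g t ∈ G t) →
      ∀ E : Set ℝ, MeasurableSet E → E ⊆ Icc (0:ℝ) b → volume E < ENNReal.ofReal δ →
        ∫ t in E, ‖g t‖ < ε) :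
    ∀ f : ℝ → EuclideanSpace ℝ (Fin d), IntegrableOn f (Icc 0 b) →
      ((∀ᵐ t ∂(volume.restrict (Icc (0:ℝ) b)), f t ∈ convexHull ℝ (G t)) ↔
        ∃ g : ℕ → ℝ → EuclideanSpace ℝ (Fin d),
          (∀ n, IntegrableOn (g n) (Icc 0 b) ∧
            ∀ᵐ t ∂(volume.restrict (Icc (0:ℝ) b)), g n t ∈ G t) ∧
          Tendsto (fun n => weakNorm b (fun s => g n s - f s)) atTop (nhds 0)) := by
  obtain ⟨g₀, hg₀⟩ := hS_ne
  obtain ⟨M, hM⟩ := exists_integral_norm_le hb (G := G) hS_ui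
  intro f hf
  constructor
  · exact exists_tendsto_weakNorm_of_ae_mem_convexHull hb hG_graph hM hg₀ hf
  · rintro ⟨g, hg, hlim⟩
    exact ae_mem_convexHull_of_tendsto_weakNorm hb hG_ne hG_cpt hM hf hg hlim
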